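/- Let t,k ≥ 3 and let G be a (K_t,𝒯_k)-co-critical graph on n vertices. If τ is a critical coloring of G with the number of red edges maximum among all critical colorings, then the red graph G_r is K_t-saturated; moreover Δ(G_r) ≤ n−2 and δ(G_r) ≥ 2(t−2). -/

import Mathlib

/-- A red/blue edge-coloring of `G`, given by its red subgraph `R ≤ G`, is a
critical coloring if the red graph is `K_t`-free and every component of the
blue graph `G \ R` has fewer than `k` vertices. -/
def IsCriticalColoring {V : Type*} (G R : SimpleGraph V) (t k : ℕ) : Prop :=
  R ≤ G ∧ (∀ S : Finset V, ¬ R.IsNClique t S) ∧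
    ∀ c : (G \ R).ConnectedComponent, c.supp.ncard < k

/-- `G` is `(K_t, 𝒯_k)`-co-critical. -/
def CoCritical {V : Type*} (G : SimpleGraph V) (t k : ℕ) : Prop :=
  G ≠ ⊤ ∧ (∃ R, IsCriticalColoring G R t k) ∧
    ∀ u v : V, u ≠ v → ¬ G.Adj u v →
      ∀ R, ¬ IsCriticalColoring (G ⊔ SimpleGraph.fromEdgeSet {s(u, v)}) R t k

open Classical in
lemma hajnal_iter {V : Type*} [Fintype V] (H : SimpleGraph V) (s : ℕ)
    (hfree : ∀ S : Finset V, ¬ H.IsNClique (s + 1) S)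
    (P : Finset V → Prop) (hP : ∀ C, P C → H.IsNClique s C)
    (W : Finset V) (hW : ∀ C, P C → C ⊆ W) (D : Finset V) :
    ∀ (m : ℕ) (A B : Finset V), A.card = m → A ⊆ B → B ⊆ W →
      H.IsClique (A : Set V) →
      (∀ a ∈ A, ∀ b ∈ B, a ≠ b → H.Adj a b) →
      (∀ a ∈ A, (∀ C, P C → a ∈ C) → a ∈ D) →
      A.card + B.card ≤ D.card + W.card := by
  intro m
  induction m using Nat.strong_induction_on with
  | _ m ih =>
  intro A B hm hAB hBW hAc hcomp hD
  by_cases h : ∀ a ∈ A, ∀ C, P C → a ∈ C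
  · have h1 : A ⊆ D := fun a ha => hD a ha (h a ha)
    exact add_le_add (Finset.card_le_card h1) (Finset.card_le_card hBW)
  · push Not at h
    obtain ⟨w, hwA, C, hC, hwC⟩ := h
    have hCc := hP C hC
    have hlt : (A ∩ C).card < m := by
      rw [← hm]
      apply Finset.card_lt_card
      refine ⟨Finset.inter_subset_left, fun hh => hwC ?_⟩
      exact (Finset.mem_inter.1 (hh hwA)).2
    have key := ih _ hlt (A ∩ C) (B ∪ C) rfl
      (fun a ha => Finset.mem_union_right _ (Finset.mem_inter.1 ha).2)
      (Finset.union_subset hBW (hW C hC))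
      (hAc.subset (by simp))
      (by
        intro a ha b hb hab
        rw [Finset.mem_inter] at ha
        rcases Finset.mem_union.1 hb with hb | hb
        · exact hcomp a ha.1 b hb hab
        · exact hCc.1 ha.2 hb hab)
      (fun a ha => hD a (Finset.mem_inter.1 ha).1)
    -- the clique (C ∩ B) ∪ A
    have hcl : H.IsClique (((C ∩ B) ∪ A : Finset V) : Set V) := by
      intro a ha b hb hab
      simp only [Finset.coe_union, Finset.coe_inter, Set.mem_union, Set.mem_inter_iff,
        Finset.mem_coe] at ha hb
      rcases ha with ha | ha <;> rcases hb with hb | hb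
      · exact hCc.1 ha.1 hb.1 hab
      · exact (hcomp b hb a ha.2 hab.symm).symm
      · exact hcomp a ha b hb.2 hab
      · exact hAc ha hb hab
    have hcard : ((C ∩ B) ∪ A).card ≤ s := by
      by_contra hgt
      push Not at hgt
      obtain ⟨S, hS, hSc⟩ := Finset.exists_subset_card_eq (Nat.succ_le_of_lt hgt)
      exact hfree S ⟨hcl.subset (by exact_mod_cast hS), hSc⟩
    have e1 : ((C ∩ B) ∪ A).card = (C ∩ B).card + (A \ C).card := by
      have : (C ∩ B) ∪ A = (C ∩ B) ∪ (A \ C) := by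
        ext a
        have := @hAB a
        simp only [Finset.mem_union, Finset.mem_inter, Finset.mem_sdiff]
        tauto
      rw [this, Finset.card_union_of_disjoint]
      rw [Finset.disjoint_left]
      intro a ha hb
      exact (Finset.mem_sdiff.1 hb).2 (Finset.mem_inter.1 ha).1
    have e2 : (C ∩ B).card + (C \ B).card = C.card := Finset.card_inter_add_card_sdiff C B
    have e3 : (A ∩ C).card + (A \ C).card = A.card := Finset.card_inter_add_card_sdiff A C
    have e4 : (B ∪ C).card = B.card + (C \ B).card := by
      rw [← Finset.card_union_of_disjoint Finset.disjoint_sdiff, Finset.union_sdiff_self_eq_union]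
    have e5 := hCc.2
    omega

open Classical in
lemma sat_clique {V : Type*} (R : SimpleGraph V) (t : ℕ)
    (hfree : ∀ S : Finset V, ¬ R.IsNClique t S)
    (hsat : ∀ u v : V, u ≠ v → ¬ R.Adj u v →
        ∃ S : Finset V, (R ⊔ SimpleGraph.fromEdgeSet {s(u, v)}).IsNClique t S)
    (u v : V) (huv : u ≠ v) (hn : ¬ R.Adj u v) :
    ∃ C : Finset V, R.IsNClique (t - 1) C ∧ u ∈ C ∧ v ∉ C ∧ ∀ c ∈ C, c ≠ u → R.Adj v c := by
  obtain ⟨S, hS⟩ := hsat u v huv hn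
  have adj : ∀ a ∈ S, ∀ b ∈ S, a ≠ b → R.Adj a b ∨ (a = u ∧ b = v) ∨ (a = v ∧ b = u) := by
    intro a ha b hb hab
    have := hS.1 ha hb hab
    simp only [SimpleGraph.sup_adj, SimpleGraph.fromEdgeSet_adj, Set.mem_singleton_iff,
      Sym2.eq_iff] at this
    tauto
  have hu : u ∈ S := by
    by_contra hu
    refine hfree S ⟨fun a ha b hb hab => ?_, hS.2⟩
    rcases adj a ha b hb hab with h | h | h
    · exact h
    · exact absurd (h.1 ▸ ha) hu
    · exact absurd (h.2 ▸ hb) hu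
  have hv : v ∈ S := by
    by_contra hv
    refine hfree S ⟨fun a ha b hb hab => ?_, hS.2⟩
    rcases adj a ha b hb hab with h | h | h
    · exact h
    · exact absurd (h.2 ▸ hb) hv
    · exact absurd (h.1 ▸ ha) hv
  refine ⟨S.erase v, ⟨?_, ?_⟩, Finset.mem_erase.2 ⟨huv, hu⟩, Finset.notMem_erase _ _, ?_⟩
  · intro a ha b hb hab
    rw [Finset.mem_coe, Finset.mem_erase] at ha hb
    rcases adj a ha.2 b hb.2 hab with h | h | h
    · exact h
    · exact absurd h.2 hb.1
    · exact absurd h.1 ha.1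
  · rw [Finset.card_erase_of_mem hv, hS.2]
  · intro c hc hcu
    rw [Finset.mem_erase] at hc
    rcases adj v hv c hc.2 (Ne.symm hc.1) with h | h | h
    · exact h
    · exact absurd h.1.symm huv
    · exact absurd h.2 hcu

open Classical in
lemma hajnal {V : Type*} [Fintype V] (R : SimpleGraph V) (t : ℕ) (ht : 3 ≤ t)
    (hfree : ∀ S : Finset V, ¬ R.IsNClique t S)
    (hsat : ∀ u v : V, u ≠ v → ¬ R.Adj u v →
        ∃ S : Finset V, (R ⊔ SimpleGraph.fromEdgeSet {s(u, v)}).IsNClique t S)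
    (hcon : ∀ v : V, ∃ u, u ≠ v ∧ ¬ R.Adj u v) (v : V) :
    2 * (t - 2) ≤ (R.neighborSet v).ncard := by
  have hsc := sat_clique R t hfree hsat
  have hfree' : ∀ S : Finset V, ¬ R.IsNClique (t - 1 + 1) S := by
    rw [show t - 1 + 1 = t by omega]; exact hfree
  let F : Finset V → Prop := fun C => R.IsNClique (t - 1) C ∧ v ∈ C
  let W1 : Finset V := Finset.univ.filter fun a => ∃ C, F C ∧ a ∈ C
  let D : Finset V := Finset.univ.filter fun a => ∀ C, F C → a ∈ C
  have hD : ∀ a, a ∈ D ↔ ∀ C, F C → a ∈ C := by simp [D]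
  have hW1 : ∀ a, a ∈ W1 ↔ ∃ C, F C ∧ a ∈ C := by simp [W1]
  obtain ⟨u0, hu0, hn0⟩ := hcon v
  obtain ⟨C0, hC0, hvC0, -, -⟩ := hsc v u0 hu0.symm (fun h => hn0 h.symm)
  have hFC0 : F C0 := ⟨hC0, hvC0⟩
  have hvD : v ∈ D := (hD v).2 fun C hC => hC.2
  have hvW : v ∈ W1 := (hW1 v).2 ⟨C0, hFC0, hvC0⟩
  have hDW : D ⊆ W1 := fun a ha => (hW1 a).2 ⟨C0, hFC0, (hD a).1 ha C0 hFC0⟩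
  have s1 := hajnal_iter R (t - 1) hfree' F (fun C h => h.1) W1
    (fun C hC a ha => (hW1 a).2 ⟨C, hC, ha⟩) D _ C0 C0 rfl (Finset.Subset.refl _)
    (fun a ha => (hW1 a).2 ⟨C0, hFC0, ha⟩) hC0.1
    (fun a ha b hb hab => hC0.1 ha hb hab) (fun a _ h => (hD a).2 h)
  rw [hC0.2] at s1
  let X : Finset V := Finset.univ.filter fun a => a ≠ v ∧ ¬ R.Adj v a
  have hX : ∀ a, a ∈ X ↔ a ≠ v ∧ ¬ R.Adj v a := by simp [X]
  have hWN : ∀ a ∈ W1, a ≠ v → R.Adj v a := by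
    intro a ha hav
    obtain ⟨C, hC, haC⟩ := (hW1 a).1 ha
    exact hC.1.1 hC.2 haC hav.symm
  have s2 := hajnal_iter R (t - 1) hfree' (fun C => R.IsNClique (t - 1) C ∧ v ∉ C)
    (fun C h => h.1) (Finset.univ.erase v)
    (fun C hC a ha => by
      simp only [Finset.mem_erase, Finset.mem_univ, and_true]
      rintro rfl; exact hC.2 ha) ∅ _ (D.erase v) (W1.erase v ∪ X) rfl
    (fun a ha => Finset.mem_union_left _ (Finset.erase_subset_erase v hDW ha))
    (fun a ha => by
      simp only [Finset.mem_erase, Finset.mem_univ, and_true]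
      rcases Finset.mem_union.1 ha with h | h
      · exact (Finset.mem_erase.1 h).1
      · exact ((hX a).1 h).1)
    (fun a ha b hb hab => by
      have ha := (Finset.mem_erase.1 (Finset.mem_coe.1 ha)).2
      have hb := (Finset.mem_erase.1 (Finset.mem_coe.1 hb)).2
      exact hC0.1 ((hD a).1 ha C0 hFC0) ((hD b).1 hb C0 hFC0) hab)
    (fun a ha b hb hab => by
      have hav := (Finset.mem_erase.1 ha).1
      have ha := (Finset.mem_erase.1 ha).2
      rcases Finset.mem_union.1 hb with h | h
      · obtain ⟨C, hC, hbC⟩ := (hW1 b).1 (Finset.mem_erase.1 h).2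
        exact hC.1.1 ((hD a).1 ha C hC) hbC hab
      · obtain ⟨hbv, hnb⟩ := (hX b).1 h
        obtain ⟨C, hC, hvC, -, hadj⟩ := hsc v b hbv.symm hnb
        exact (hadj a ((hD a).1 ha C ⟨hC, hvC⟩) hav).symm)
    (fun a ha h => by
      exfalso
      have ha := (Finset.mem_erase.1 ha).2
      obtain ⟨u, hu, hn⟩ := hcon a
      obtain ⟨C, hC, -, haC, -⟩ := hsc u a hu hn
      by_cases hvC : v ∈ C
      · exact haC ((hD a).1 ha C ⟨hC, hvC⟩)
      · exact haC (h C ⟨hC, hvC⟩))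
  have c1 : (W1.erase v ∪ X).card = (W1.erase v).card + X.card := by
    apply Finset.card_union_of_disjoint
    rw [Finset.disjoint_left]
    intro a ha hb
    rw [Finset.mem_erase] at ha
    exact ((hX a).1 hb).2 (hWN a ha.2 ha.1)
  have c2 := Finset.card_erase_add_one hvW
  have c3 := Finset.card_erase_add_one hvD
  have c4 := Finset.card_erase_add_one (Finset.mem_univ v)
  let N : Finset V := Finset.univ.filter fun a => R.Adj v a
  have c5 : (R.neighborSet v).ncard = N.card := by
    rw [← Set.ncard_coe_finset]
    congr 1
    ext a; simp [N]
  have c6 : N.card + X.card = (Finset.univ.erase v).card := by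
    rw [← Finset.card_union_of_disjoint]
    · congr 1
      ext a
      simp only [Finset.mem_union, N, X, Finset.mem_filter, Finset.mem_univ, true_and,
        Finset.mem_erase, and_true]
      have : R.Adj v a → a ≠ v := fun h => h.ne'
      tauto
    · rw [Finset.disjoint_left]
      intro a ha hb
      simp only [N, X, Finset.mem_filter] at ha hb
      exact hb.2.2 ha.2
  simp only [Finset.card_empty] at s2
  omega

lemma supp_bound {V : Type*} [Fintype V] (H H' : SimpleGraph V) (k : ℕ)
    (E : Set V) (hE : E.ncard < k)
    (hH : ∀ c : H.ConnectedComponent, c.supp.ncard < k)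
    (h : ∀ a b, H'.Adj a b → (a ∈ E ∧ b ∈ E) ∨ (a ∉ E ∧ b ∉ E ∧ H.Adj a b))
    (c : H'.ConnectedComponent) : c.supp.ncard < k := by
  have key : ∀ a b, H'.Reachable a b →
      (a ∈ E ∧ b ∈ E) ∨ (a ∉ E ∧ b ∉ E ∧ H.Reachable a b) := by
    rintro a b ⟨p⟩
    induction p with
    | nil =>
      rename_i u
      by_cases hu : u ∈ E
      · exact Or.inl ⟨hu, hu⟩
      · exact Or.inr ⟨hu, hu, SimpleGraph.Reachable.refl _⟩
    | cons hadj p ih =>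
      rcases h _ _ hadj with h1 | h1 <;> rcases ih with h2 | h2
      · exact Or.inl ⟨h1.1, h2.2⟩
      · exact absurd h1.2 h2.1
      · exact absurd h2.1 h1.2.1
      · exact Or.inr ⟨h1.1, h2.2.1, h1.2.2.reachable.trans h2.2.2⟩
  induction c using SimpleGraph.ConnectedComponent.ind with
  | _ a =>
  by_cases ha : a ∈ E
  · refine lt_of_le_of_lt (Set.ncard_le_ncard (fun b hb => ?_) (Set.toFinite _)) hE
    have hb := SimpleGraph.ConnectedComponent.exact (hb : H'.connectedComponentMk b = _)
    rcases key _ _ hb with h1 | h1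
    · exact h1.1
    · exact absurd ha h1.2.1
  · refine lt_of_le_of_lt (Set.ncard_le_ncard (fun b hb => ?_) (Set.toFinite _))
      (hH (H.connectedComponentMk a))
    have hb := SimpleGraph.ConnectedComponent.exact (hb : H'.connectedComponentMk b = _)
    rcases key _ _ hb with h1 | h1
    · exact absurd h1.2 ha
    · exact SimpleGraph.ConnectedComponent.sound h1.2.2

open Classical in
lemma no_conical {V : Type*} [Fintype V] (t k : ℕ) (hk : 3 ≤ k)
    (G : SimpleGraph V) (hG : CoCritical G t k)
    (R : SimpleGraph V) (hR : IsCriticalColoring G R t k) (v : V) :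
    ∃ u, u ≠ v ∧ ¬ R.Adj u v := by
  by_contra hcon
  push Not at hcon
  obtain ⟨hle, hfree, hblue⟩ := hR
  obtain ⟨x, y, hxy, hnxy⟩ := SimpleGraph.ne_top_iff_exists_not_adj.1 hG.1
  have hxv : x ≠ v := by
    rintro rfl
    exact hnxy (hle (hcon y hxy.symm)).symm
  let R' : SimpleGraph V :=
    { Adj := fun a b => (G ⊔ SimpleGraph.fromEdgeSet {s(x, y)}).Adj a b ∧
        ¬ (a = x ∧ b = v) ∧ ¬ (a = v ∧ b = x) ∧ (R.Adj a b ∨ a = x ∨ b = x)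
      symm := ⟨fun a b h => ⟨h.1.symm, by tauto, by tauto, by
        rcases h.2.2.2 with h | h | h
        · exact Or.inl h.symm
        · exact Or.inr (Or.inr h)
        · exact Or.inr (Or.inl h)⟩⟩
      loopless := ⟨fun a h => h.1.ne rfl⟩ }
  have hR' : ∀ a b, R'.Adj a b ↔ ((G ⊔ SimpleGraph.fromEdgeSet {s(x, y)}).Adj a b ∧
        ¬ (a = x ∧ b = v) ∧ ¬ (a = v ∧ b = x) ∧ (R.Adj a b ∨ a = x ∨ b = x)) :=
    fun a b => Iff.rfl
  refine hG.2.2 x y hxy hnxy R' ⟨fun a b h => h.1, ?_, ?_⟩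
  · intro S hS
    by_cases hx : x ∈ S
    · have hv : v ∉ S := fun hv => ((hR' _ _).1 (hS.1 hx hv hxv)).2.1 ⟨rfl, rfl⟩
      refine hfree (insert v (S.erase x)) ⟨?_, ?_⟩
      · intro a ha b hb hab
        simp only [Finset.coe_insert, Finset.coe_erase, Set.mem_insert_iff, Set.mem_diff,
          Finset.mem_coe, Set.mem_singleton_iff] at ha hb
        rcases ha with rfl | ha
        · exact (hcon b hab.symm).symm
        · rcases hb with rfl | hb
          · exact hcon a hab
          · have := ((hR' _ _).1 (hS.1 ha.1 hb.1 hab)).2.2.2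
            tauto
      · rw [Finset.card_insert_of_notMem (fun h => hv (Finset.mem_of_mem_erase h)),
          Finset.card_erase_add_one hx, hS.2]
    · refine hfree S ⟨fun a ha b hb hab => ?_, hS.2⟩
      rcases ((hR' _ _).1 (hS.1 ha hb hab)).2.2.2 with h | h | h
      · exact h
      · exact absurd (h ▸ ha) hx
      · exact absurd (h ▸ hb) hx
  · refine supp_bound (G \ R) _ k {x, v} ?_ hblue ?_
    · rw [Set.ncard_pair hxv]; omega
    · intro a b hab
      rw [SimpleGraph.sdiff_adj, hR'] at hab
      obtain ⟨h1, h2⟩ := hab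
      have hne := h1.ne
      simp only [Set.mem_insert_iff, Set.mem_singleton_iff]
      by_cases ha : (a = x ∧ b = v) ∨ (a = v ∧ b = x)
      · left; tauto
      · have h3 : ¬ R.Adj a b ∧ a ≠ x ∧ b ≠ x := by tauto
        right
        have hav : a ≠ v := by
          rintro rfl
          exact h3.1 (hcon b hne.symm).symm
        have hbv : b ≠ v := by
          rintro rfl
          exact h3.1 (hcon a hne)
        have hGab : G.Adj a b := by
          simp only [SimpleGraph.sup_adj, SimpleGraph.fromEdgeSet_adj, Set.mem_singleton_iff,
            Sym2.eq_iff] at h1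
          tauto
        rw [SimpleGraph.sdiff_adj]
        tauto

/-- if `R` is a critical coloring of a `(K_t, 𝒯_k)`-co-critical
graph `G` on `n` vertices with the number of red edges maximum, then the red
graph is `K_t`-saturated, `Δ(G_r) ≤ n - 2` and `δ(G_r) ≥ 2(t-2)`. -/
theorem stmt_6 {V : Type*} [Fintype V] (t k : ℕ) (ht : 3 ≤ t) (hk : 3 ≤ k)
    (G : SimpleGraph V) (hG : CoCritical G t k)
    (R : SimpleGraph V) (hR : IsCriticalColoring G R t k)
    (hmax : ∀ R' : SimpleGraph V, IsCriticalColoring G R' t k →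
      R'.edgeSet.ncard ≤ R.edgeSet.ncard) :
    ((∀ S : Finset V, ¬ R.IsNClique t S) ∧
      ∀ u v : V, u ≠ v → ¬ R.Adj u v →
        ∃ S : Finset V, (R ⊔ SimpleGraph.fromEdgeSet {s(u, v)}).IsNClique t S) ∧
    (∀ v : V, (R.neighborSet v).ncard ≤ Fintype.card V - 2) ∧
    (∀ v : V, 2 * (t - 2) ≤ (R.neighborSet v).ncard) := by
  have hsat : ∀ u v : V, u ≠ v → ¬ R.Adj u v →
        ∃ S : Finset V, (R ⊔ SimpleGraph.fromEdgeSet {s(u, v)}).IsNClique t S := by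
    intro u v huv hn
    by_contra hno
    push Not at hno
    obtain ⟨hle, hfree, hblue⟩ := hR
    by_cases hadj : G.Adj u v
    · have hcrit : IsCriticalColoring G (R ⊔ SimpleGraph.fromEdgeSet {s(u, v)}) t k := by
        refine ⟨sup_le hle ?_, hno, ?_⟩
        · intro a b h
          simp only [SimpleGraph.fromEdgeSet_adj, Set.mem_singleton_iff, Sym2.eq_iff] at h
          rcases h.1 with ⟨rfl, rfl⟩ | ⟨rfl, rfl⟩
          · exact hadj
          · exact hadj.symm
        · refine supp_bound (G \ R) _ k ∅ (by simp; omega) hblue ?_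
          intro a b h
          rw [SimpleGraph.sdiff_adj, SimpleGraph.sup_adj] at h
          right
          rw [SimpleGraph.sdiff_adj]
          exact ⟨by simp, by simp, h.1, fun h' => h.2 (Or.inl h')⟩
      have h1 := hmax _ hcrit
      refine absurd h1 (not_le.2 (Set.ncard_lt_ncard ?_ (Set.toFinite _)))
      refine SimpleGraph.edgeSet_ssubset_edgeSet.2 (lt_of_le_of_ne le_sup_left fun h => hn ?_)
      rw [h]
      simp [huv]
    · refine hG.2.2 u v huv hadj (R ⊔ SimpleGraph.fromEdgeSet {s(u, v)})
        ⟨sup_le_sup_right hle _, hno, ?_⟩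
      refine supp_bound (G \ R) _ k ∅ (by simp; omega) hblue ?_
      intro a b h
      simp only [SimpleGraph.sdiff_adj, SimpleGraph.sup_adj] at h
      right
      rw [SimpleGraph.sdiff_adj]
      refine ⟨by simp, by simp, ?_, ?_⟩ <;> tauto
  have hcon := no_conical t k hk G hG R hR
  refine ⟨⟨hR.2.1, hsat⟩, ?_, hajnal R t ht hR.2.1 hsat hcon⟩
  intro v
  obtain ⟨u, huv, hn⟩ := hcon v
  have h1 : R.neighborSet v ⊆ ({u, v} : Set V)ᶜ := by
    intro a ha
    simp only [Set.mem_compl_iff, Set.mem_insert_iff, Set.mem_singleton_iff, not_or]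
    refine ⟨?_, ?_⟩
    · rintro rfl; exact hn (SimpleGraph.Adj.symm ha)
    · rintro rfl; exact SimpleGraph.irrefl _ ha
  refine (Set.ncard_le_ncard h1 (Set.toFinite _)).trans ?_
  rw [Set.ncard_compl, Set.ncard_pair huv, Nat.card_eq_fintype_card]
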